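/- Let α ∈ K^× be a 1-exceptional element. Then N_{K/F}(α) is a p-th power in K^×, and every β ∈ K^× with β^p = N_{K/F}(α) satisfies σ(β)·β^{-1} = ξ_p. Moreover, α ∉ K_{n-1}^×. -/

import Mathlib

/-!
Common setup.  Throughout, `K/F` is a cyclic Galois extension of degree `p^n`
with Galois group `G = Gal(K/F)` generated by `σ`.  For `0 ≤ i ≤ n`, `K_i`
denotes the intermediate field of degree `p^i` over `F`, realized here via its
unit group `KiU p σ i` (the units of `K` fixed by `σ^{p^i}`), and
`G_i = Gal(K_i/F)`.  For `m ≥ 1`, `R_m = ℤ/p^m` and `J_m = K^×/K^{×p^m}`.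
-/

namespace MSS

variable {F K : Type*} [Field F] [Field K] [Algebra F K]

/-- Action of a field automorphism on the unit group. -/
def umap (σ : K ≃ₐ[F] K) : Kˣ →* Kˣ := Units.map (σ : K →* K)

/-- The norm from `K_j` to `F`, computed in `K` as the product of conjugates
`∏_{k < p^j} σ^k(γ)` (valid for `γ ∈ K_j`). -/
noncomputable def normHom (p : ℕ) (σ : K ≃ₐ[F] K) (j : ℕ) : Kˣ →* Kˣ :=
  ∏ k ∈ Finset.range (p ^ j), umap (σ ^ k)

/-- The unit group of the intermediate field `K_i`: the units fixed by `σ^{p^i}`. -/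
def KiU (p : ℕ) (σ : K ≃ₐ[F] K) (i : ℕ) : Subgroup Kˣ :=
  (umap (σ ^ p ^ i) / MonoidHom.id Kˣ).ker

/-- Membership in `K_a^×` for a level `a ∈ {-∞, 0, 1, …}`; level `-∞` means
the trivial group `{1}`. -/
def levelMem (p : ℕ) (σ : K ≃ₐ[F] K) (a : WithBot ℕ) (γ : Kˣ) : Prop :=
  WithBot.recBotCoe (γ = 1) (fun i => γ ∈ KiU p σ i) a

/-- `(α, δ)` represents the pair `(a, d)`:  `σ(α)·α^{-d} = ∏_{i=0}^m δ_i^{p^i}` with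
`δ_i ∈ K_{a_i}^×` for `i < m`, and
`ξ_p = N_{K/F}(α)^{(d-1)/p} · N_{K_{n-1}/F}(δ_0) · ∏_{i=1}^m N_{K/F}(δ_i)^{p^{i-1}}`. -/
noncomputable def Represents (p n : ℕ) (σ : K ≃ₐ[F] K) (ξ : Kˣ) {m : ℕ}
    (a : Fin m → WithBot ℕ) (d : ℤ) (α : Kˣ) (δ : ℕ → Kˣ) : Prop :=
  (∀ i : Fin m, levelMem p σ (a i) (δ i)) ∧
  umap σ α = α ^ d * ∏ i ∈ Finset.range (m + 1), δ i ^ p ^ i ∧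
  ξ = normHom p σ n α ^ ((d - 1) / (p : ℤ)) * normHom p σ (n - 1) (δ 0) *
      ∏ i ∈ Finset.Icc 1 m, normHom p σ n (δ i) ^ p ^ (i - 1)

/-- `(a, d)` is a norm pair of length `m`: `a ∈ {-∞,0,…,n}^m` with `a_0 < n`,
`d ∈ U_1`, and some `(α, δ)` represents `(a, d)`. -/
noncomputable def IsNormPair (p n : ℕ) (σ : K ≃ₐ[F] K) (ξ : Kˣ) {m : ℕ}
    (a : Fin m → WithBot ℕ) (d : ℤ) : Prop :=
  (∀ i, a i ≤ (n : WithBot ℕ)) ∧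
  (∀ h0 : 0 < m, a ⟨0, h0⟩ < (n : WithBot ℕ)) ∧
  (p : ℤ) ∣ d - 1 ∧
  ∃ (α : Kˣ) (δ : ℕ → Kˣ), Represents p n σ ξ a d α δ

/-- Strict lexicographic order on norm vectors (with `-∞` smallest). -/
def vecLT {m : ℕ} (a a' : Fin m → WithBot ℕ) : Prop :=
  ∃ k : Fin m, (∀ j : Fin m, j < k → a j = a' j) ∧ a k < a' k

/-- The order `d ≤_m d'` on twists: `d' ∈ U_i → d ∈ U_i` for `1 ≤ i ≤ m`, except
when `p = 2` and `d, d' ∉ U_2`, in which case `d' ∈ -U_i → d ∈ -U_i` for `2 ≤ i ≤ m`. -/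
def twistLE (p m : ℕ) (d d' : ℤ) : Prop :=
  ((p = 2 ∧ ¬ (4 : ℤ) ∣ (d - 1) ∧ ¬ (4 : ℤ) ∣ (d' - 1)) →
    ∀ i : ℕ, 2 ≤ i → i ≤ m → ((2 : ℤ) ^ i ∣ (d' + 1)) → ((2 : ℤ) ^ i ∣ (d + 1))) ∧
  (¬ (p = 2 ∧ ¬ (4 : ℤ) ∣ (d - 1) ∧ ¬ (4 : ℤ) ∣ (d' - 1)) →
    ∀ i : ℕ, 1 ≤ i → i ≤ m → ((p : ℤ) ^ i ∣ (d' - 1)) → ((p : ℤ) ^ i ∣ (d - 1)))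

/-- The order `⪯_m` on norm pairs of length `m`. -/
def pairLE (p : ℕ) {m : ℕ} (a : Fin m → WithBot ℕ) (d : ℤ)
    (a' : Fin m → WithBot ℕ) (d' : ℤ) : Prop :=
  vecLT a a' ∨ (a = a' ∧ twistLE p m d d')

/-- `(a, d)` is a minimal norm pair of length `m`. -/
noncomputable def IsMinimalNormPair (p n : ℕ) (σ : K ≃ₐ[F] K) (ξ : Kˣ) {m : ℕ}
    (a : Fin m → WithBot ℕ) (d : ℤ) : Prop :=
  IsNormPair p n σ ξ a d ∧
  ∀ (a' : Fin m → WithBot ℕ) (d' : ℤ), IsNormPair p n σ ξ a' d' → pairLE p a d a' d'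

/-- `α` is an `m`-exceptional element. -/
noncomputable def IsExceptional (p n : ℕ) (σ : K ≃ₐ[F] K) (ξ : Kˣ) (m : ℕ) (α : Kˣ) : Prop :=
  ∃ (a : Fin m → WithBot ℕ) (d : ℤ) (δ : ℕ → Kˣ),
    IsMinimalNormPair p n σ ξ a d ∧ Represents p n σ ξ a d α δ

/-- The subgroup of `q`-th powers in `K^×`. -/
def powSub (K : Type*) [Field K] (q : ℕ) : Subgroup Kˣ := (powMonoidHom q : Kˣ →* Kˣ).range

/-- The class of a unit in `J_q := K^×/K^{×q}`. -/
def jcls (q : ℕ) (γ : Kˣ) : Kˣ ⧸ powSub K q := QuotientGroup.mk γ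

/-- The action of a field automorphism on `J_q = K^×/K^{×q}`. -/
noncomputable def jmap (q : ℕ) (τ : K ≃ₐ[F] K) : (Kˣ ⧸ powSub K q) →* Kˣ ⧸ powSub K q :=
  QuotientGroup.map _ _ (umap τ) (by
    rintro x ⟨y, rfl⟩
    exact ⟨umap τ y, by simp [powMonoidHom, map_pow]⟩)

/-- The natural map `J_q → J_{q'}` when `q' ∣ q`. -/
noncomputable def resMap (q q' : ℕ) (h : q' ∣ q) : (Kˣ ⧸ powSub K q) →* Kˣ ⧸ powSub K q' :=
  QuotientGroup.map _ _ (MonoidHom.id Kˣ) (by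
    rintro x ⟨y, rfl⟩
    obtain ⟨c, rfl⟩ := h
    exact ⟨y ^ c, by simp [powMonoidHom, ← pow_mul, mul_comm]⟩)

/-- The `R_m[G]`-submodule of `J_q` generated by the classes of the elements of `S`:
the subgroup generated by all `σ^k`-conjugates of classes of elements of `S`. -/
noncomputable def galSpan (q : ℕ) (σ : K ≃ₐ[F] K) (S : Set Kˣ) : Subgroup (Kˣ ⧸ powSub K q) :=
  Subgroup.closure {x | ∃ γ ∈ S, ∃ k : ℕ, x = jcls q (umap (σ ^ k) γ)}

/-- The subgroup `(σ-1)J_q` of `J_q`. -/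
noncomputable def augSub (q : ℕ) (σ : K ≃ₐ[F] K) : Subgroup (Kˣ ⧸ powSub K q) :=
  Subgroup.closure {x | ∃ y : Kˣ ⧸ powSub K q, x = jmap q σ y * y⁻¹}

/-- The cyclic `F_p[G]`-submodule of `J_1 = K^×/K^{×p}` generated by `[γ]_1` is a
free `F_p[G_i]`-module (on the generator `[γ]_1`): `[γ]_1` is fixed by `σ^{p^i}`
and the conjugates `σ^k [γ]_1`, `k < p^i`, are `F_p`-linearly independent. -/
noncomputable def FreeCyc (p : ℕ) (σ : K ≃ₐ[F] K) (i : ℕ) (γ : Kˣ) : Prop :=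
  jcls p (umap (σ ^ p ^ i) γ) = jcls p γ ∧
  ∀ c : Fin (p ^ i) → ZMod p,
    (∏ k : Fin (p ^ i), jcls p (umap (σ ^ (k : ℕ)) γ) ^ (c k).val) = 1 → c = 0

/-- An (indexed) internal direct sum decomposition of a commutative group. -/
def IsDirectSumDecomp {G : Type*} [CommGroup G] {ι : Sort*} (f : ι → Subgroup G) : Prop :=
  iSupIndep f ∧ (⨆ i, f i) = ⊤

/-- The subgroup `F^×` of `K^×` (units coming from the base field). -/
def Funits (F : Type*) {K : Type*} [Field F] [Field K] [Algebra F K] : Subgroup Kˣ :=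
  (Units.map (algebraMap F K : F →* K)).range

/-- The subgroup `F^{×p}` of `K^×`. -/
def FpPow (F : Type*) {K : Type*} [Field F] [Field K] [Algebra F K] (p : ℕ) : Subgroup Kˣ :=
  (Funits F).map (powMonoidHom p)

/-- The subgroup `N_{K_i/F}(K_i^×)` of `K^×`. -/
noncomputable def NormSub (p : ℕ) (σ : K ≃ₐ[F] K) (i : ℕ) : Subgroup Kˣ :=
  (KiU p σ i).map (normHom p σ i)

/-- The subgroup `N_{K_i/F}(K_i^×)·F^{×p}` of `K^×`. -/
noncomputable def NiF (p : ℕ) (σ : K ≃ₐ[F] K) (i : ℕ) : Subgroup Kˣ :=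
  NormSub p σ i ⊔ FpPow F p

/-- The `F_p`-dimension of an (elementary abelian `p`-) commutative group `Q`,
computed as the rank of `F_p ⊗_ℤ Q`. -/
noncomputable def fpdim (p : ℕ) (Q : Type*) [CommGroup Q] : Cardinal :=
  Module.rank (ZMod p) (TensorProduct ℤ (ZMod p) (Additive Q))

/-- The invariant `e_i(K/F)`: for `i < n` the `F_p`-dimension of
`N_{K_i/F}(K_i^×)F^{×p} / N_{K_{i+1}/F}(K_{i+1}^×)F^{×p}`, and for `i = n` the
`F_p`-dimension of `N_{K/F}(K^×)F^{×p}/F^{×p}`. -/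
noncomputable def eKF (p n : ℕ) (σ : K ≃ₐ[F] K) (i : ℕ) : Cardinal :=
  if i < n then
    fpdim p ((NiF p σ i) ⧸ (NiF p σ (i + 1)).subgroupOf (NiF p σ i))
  else
    fpdim p ((NiF p σ n) ⧸ (FpPow F p).subgroupOf (NiF p σ n))

/-- The group ring `R_m[G_i] = (ℤ/p^m)[ℤ/p^i]` (for the cyclic group `G_i` of order
`p^i`). -/
abbrev CycGR (p m i : ℕ) : Type :=
  MonoidAlgebra (ZMod (p ^ m)) (Multiplicative (ZMod (p ^ i)))

/-- The image of the generator `σ` of `G_i` in the group ring `R_m[G_i]`. -/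
noncomputable def gen (p m i : ℕ) : CycGR p m i :=
  MonoidAlgebra.of _ _ (Multiplicative.ofAdd (1 : ZMod (p ^ i)))

/-- Standard basis vector of the free `R_m[G]`-module on generators `e_0, …, e_m`. -/
noncomputable def sing (p n m : ℕ) (j : Fin (m + 1)) (c : CycGR p m n) :
    Fin (m + 1) → CycGR p m n :=
  Pi.single j c

/-- The relations defining the module `X_{a,d,m}`: on generators `y = e_0` and
`x_i = e_{i+1}` (`0 ≤ i < m`), we impose `(σ - d)·y = Σ_i p^i x_i`, and
`(σ^{p^{a_i}} - 1)·x_i = 0` when `a_i ≠ -∞`, resp. `x_i = 0` when `a_i = -∞`. -/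
noncomputable def XRels (p n m : ℕ) (a : Fin m → WithBot ℕ) (d : ℤ) :
    Set (Fin (m + 1) → CycGR p m n) :=
  insert
    (sing p n m 0 (gen p m n - (d : ZMod (p ^ m)) • 1) -
      ∑ i : Fin m, sing p n m i.succ ((p : CycGR p m n) ^ (i : ℕ)))
    {r | ∃ i : Fin m, r = sing p n m i.succ
      (WithBot.recBotCoe (1 : CycGR p m n) (fun k => gen p m n ^ p ^ k - 1) (a i))}

/-- The `R_m[G]`-module `X_{a,d,m}`. -/
noncomputable abbrev Xadm (p n m : ℕ) (a : Fin m → WithBot ℕ) (d : ℤ) :=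
  (Fin (m + 1) → CycGR p m n) ⧸ Submodule.span (CycGR p m n) (XRels p n m a d)

/-- Indecomposability of a module. -/
def IsIndecomposable (R M : Type*) [Ring R] [AddCommGroup M] [Module R M] : Prop :=
  (⊤ : Submodule R M) ≠ ⊥ ∧
  ∀ S T : Submodule R M, S ⊓ T = ⊥ → S ⊔ T = ⊤ → S = ⊥ ∨ T = ⊥

end MSS

universe u v

namespace MSS

section Helpers

variable {F K : Type*} [Field F] [Field K] [Algebra F K]

@[simp]
lemma coe_umap (σ : K ≃ₐ[F] K) (x : Kˣ) : ((umap σ x : Kˣ) : K) = σ x := rfl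

lemma umap_mul_apply (σ τ : K ≃ₐ[F] K) (x : Kˣ) :
    umap (σ * τ) x = umap σ (umap τ x) := rfl

@[simp]
lemma umap_one_apply (x : Kˣ) : umap (1 : K ≃ₐ[F] K) x = x := rfl

lemma mem_KiU {p : ℕ} {σ : K ≃ₐ[F] K} {i : ℕ} {x : Kˣ} :
    x ∈ KiU p σ i ↔ umap (σ ^ p ^ i) x = x := by
  simp [KiU, MonoidHom.mem_ker, div_eq_one]

lemma normHom_apply (p : ℕ) (σ : K ≃ₐ[F] K) (j : ℕ) (x : Kˣ) :
    normHom p σ j x = ∏ k ∈ Finset.range (p ^ j), umap (σ ^ k) x := by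
  simp [normHom, MonoidHom.finsetProd_apply]

/-- The partial norm `∏_{k<m} τ^k x`. -/
noncomputable def partialNorm (τ : K ≃ₐ[F] K) (m : ℕ) (x : Kˣ) : Kˣ :=
  ∏ k ∈ Finset.range m, umap (τ ^ k) x

lemma partialNorm_succ (τ : K ≃ₐ[F] K) (m : ℕ) (x : Kˣ) :
    partialNorm τ (m + 1) x = partialNorm τ m x * umap (τ ^ m) x :=
  Finset.prod_range_succ _ _

lemma umap_partialNorm_mul (τ : K ≃ₐ[F] K) (m : ℕ) (x : Kˣ) :
    umap τ (partialNorm τ m x) * x = partialNorm τ (m + 1) x := by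
  rw [partialNorm, partialNorm, Finset.prod_range_succ', map_prod]
  simp [pow_succ', umap_mul_apply]

lemma partialNorm_mul (τ : K ≃ₐ[F] K) (a b : ℕ) (x : Kˣ) :
    partialNorm τ (a * b) x = partialNorm τ a (partialNorm (τ ^ a) b x) := by
  induction b with
  | zero => simp [partialNorm]
  | succ b ih =>
    rw [partialNorm_succ, Nat.mul_succ, partialNorm, Finset.prod_range_add, ← partialNorm, ih]
    simp only [partialNorm, map_mul, Finset.prod_mul_distrib]
    congr 1
    refine Finset.prod_congr rfl fun k _ => ?_
    rw [← umap_mul_apply, ← pow_mul, ← pow_add, add_comm]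

lemma partialNorm_comm (τ : K ≃ₐ[F] K) (a b c : ℕ) (x : Kˣ) :
    partialNorm τ a (partialNorm (τ ^ c) b x) = partialNorm (τ ^ c) b (partialNorm τ a x) := by
  simp only [partialNorm, map_prod]
  rw [Finset.prod_comm]
  refine Finset.prod_congr rfl fun i _ => Finset.prod_congr rfl fun j _ => ?_
  rw [← umap_mul_apply, ← umap_mul_apply, ← pow_mul, ← pow_add, ← pow_add, add_comm]

lemma umap_pow_eq_self {τ : K ≃ₐ[F] K} {x : Kˣ} (h : umap τ x = x) (k : ℕ) :
    umap (τ ^ k) x = x := by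
  induction k with
  | zero => simp
  | succ k ih => rw [pow_succ, umap_mul_apply, h, ih]

lemma partialNorm_of_fixed {τ : K ≃ₐ[F] K} {x : Kˣ} (h : umap τ x = x) (m : ℕ) :
    partialNorm τ m x = x ^ m := by
  simp [partialNorm, umap_pow_eq_self h]

lemma KiU_mono {p : ℕ} {σ : K ≃ₐ[F] K} {i j : ℕ} (hij : i ≤ j) : KiU p σ i ≤ KiU p σ j := by
  intro x hx
  rw [mem_KiU] at hx ⊢
  obtain ⟨k, rfl⟩ := Nat.exists_eq_add_of_le hij
  rw [pow_add, pow_mul]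
  exact umap_pow_eq_self hx _

lemma normHom_eq_partialNorm (p : ℕ) (σ : K ≃ₐ[F] K) (j : ℕ) (x : Kˣ) :
    normHom p σ j x = partialNorm σ (p ^ j) x := normHom_apply p σ j x

lemma umap_normHom_mul (p : ℕ) (σ : K ≃ₐ[F] K) (j : ℕ) (x : Kˣ) :
    umap σ (normHom p σ j x) * x = normHom p σ j x * umap (σ ^ p ^ j) x := by
  rw [normHom_eq_partialNorm, umap_partialNorm_mul, partialNorm_succ]

lemma umap_normHom_of_mem {p : ℕ} {σ : K ≃ₐ[F] K} {j : ℕ} {x : Kˣ} (hx : x ∈ KiU p σ j) :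
    umap σ (normHom p σ j x) = normHom p σ j x := by
  have h := umap_normHom_mul p σ j x
  rw [mem_KiU.1 hx] at h
  exact mul_right_cancel h

lemma normHom_umap (p : ℕ) (σ : K ≃ₐ[F] K) (j : ℕ) (x : Kˣ) :
    normHom p σ j (umap σ x) = umap σ (normHom p σ j x) := by
  simp only [normHom_apply, map_prod, ← umap_mul_apply]
  exact Finset.prod_congr rfl fun k _ => by rw [← pow_succ, ← pow_succ']

lemma normHom_succ (p : ℕ) (σ : K ≃ₐ[F] K) (j : ℕ) (x : Kˣ) :
    normHom p σ (j + 1) x = normHom p σ j (partialNorm (σ ^ p ^ j) p x) := by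
  rw [normHom_eq_partialNorm, normHom_eq_partialNorm, pow_succ, partialNorm_mul]

/-- If `τ α = α c ν^p` with `c` fixed by `τ`, the partial norms of `α` are explicit. -/
lemma partialNorm_of_umap_eq {τ : K ≃ₐ[F] K} {α c ν : Kˣ} {p : ℕ} (hc : umap τ c = c)
    (h : umap τ α = α * c * ν ^ p) (m : ℕ) :
    partialNorm τ m α = α ^ m * c ^ (∑ j ∈ Finset.range m, j) *
      (∏ j ∈ Finset.range m, partialNorm τ j ν) ^ p := by
  have key : ∀ j, umap (τ ^ j) α = α * c ^ j * partialNorm τ j ν ^ p := by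
    intro j
    induction j with
    | zero => simp [partialNorm]
    | succ j ih =>
      rw [pow_succ, umap_mul_apply, h, map_mul, map_mul, map_pow, ih, umap_pow_eq_self hc,
        partialNorm_succ, mul_pow, pow_succ c]
      simp only [mul_assoc, mul_comm, mul_left_comm]
  simp only [partialNorm] at key ⊢
  simp only [key, Finset.prod_mul_distrib, Finset.prod_pow, Finset.prod_const, Finset.card_range,
    ← Finset.prod_pow_eq_pow_sum]

lemma umap_prod_partialNorm (τ : K ≃ₐ[F] K) (m : ℕ) (ν : Kˣ) :
    umap τ (∏ j ∈ Finset.range m, partialNorm τ j ν) * ν ^ m =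
      (∏ j ∈ Finset.range m, partialNorm τ j ν) * partialNorm τ m ν := by
  have h0 : partialNorm τ 0 ν = 1 := by simp [partialNorm]
  have : ν ^ m = ∏ _j ∈ Finset.range m, ν := by simp
  rw [this, map_prod, ← Finset.prod_mul_distrib, ← Finset.prod_range_succ,
    Finset.prod_range_succ', h0, mul_one]
  exact Finset.prod_congr rfl fun j _ => umap_partialNorm_mul τ j ν

/-- A degree-two instance of Hilbert 90. -/
lemma exists_umap_eq_mul_of_sq_eq_one {σ : K ≃ₐ[F] K} (hσ : σ ^ 2 = 1) (hσ1 : σ ≠ 1) {x : Kˣ}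
    (hx : x * umap σ x = 1) : ∃ α : Kˣ, umap σ α = α * x := by
  have hinv : ∀ y : K, σ (σ y) = y := fun y => by
    have := DFunLike.congr_fun hσ y
    rwa [pow_two] at this
  have hx' : (x : K) * σ x = 1 := by simpa using congrArg Units.val hx
  by_cases h : (1 : K) + σ x = 0
  · have hσx : σ (x : K) = -1 := by linear_combination h
    have hx1 : (x : K) = -1 := by rw [hσx] at hx'; linear_combination -hx'
    obtain ⟨y, hy⟩ : ∃ y, σ y ≠ y := by
      by_contra! hall
      exact hσ1 (AlgEquiv.ext hall)
    refine ⟨Units.mk0 (σ y - y) (sub_ne_zero.2 hy), Units.ext ?_⟩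
    simp [hinv, hx1]
  · refine ⟨Units.mk0 _ h, Units.ext ?_⟩
    simp only [coe_umap, Units.val_mk0, Units.val_mul, map_add, map_one, hinv]
    linear_combination -hx'

/-- In degree two, if `-1` is a norm then minimal norm pairs of length one have level `-∞`. -/
lemma eq_bot_of_isMinimalNormPair {σ : K ≃ₐ[F] K} (hσ : σ ^ 2 = 1) (hσ1 : σ ≠ 1) {γ : Kˣ}
    (hγ : normHom 2 σ 1 γ = -1) {a : Fin 1 → WithBot ℕ} {d : ℤ}
    (ha : IsMinimalNormPair 2 1 σ (-1) a d) : a 0 = ⊥ := by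
  have hγ' : γ * umap σ γ = -1 := by
    simpa [normHom_apply, Finset.prod_range_succ] using hγ
  obtain ⟨α, hα⟩ : ∃ α : Kˣ, umap σ α = α * γ ^ 2 :=
    exists_umap_eq_mul_of_sq_eq_one hσ hσ1 (by rw [map_pow, ← mul_pow, hγ']; simp)
  have hpair : IsNormPair 2 1 σ (-1) (fun _ : Fin 1 => (⊥ : WithBot ℕ)) 1 := by
    refine ⟨by simp, by simp, by simp, α, fun i => if i = 1 then γ else 1, ?_, ?_, ?_⟩
    · simp [levelMem]
    · simp [hα]
    · simp [hγ]
  rcases ha.2 _ _ hpair with ⟨k, -, hk⟩ | ⟨h, -⟩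
  · exact absurd hk not_lt_bot
  · rw [h]

lemma exists_pow_eq_normHom {σ : K ≃ₐ[F] K} {p j : ℕ} {α δ η : Kˣ} {e : Kˣ}
    (hδ : δ ∈ KiU p σ j) (hα : umap σ α = α * δ * η ^ p) (he : umap σ e = e)
    (hep : e ^ p = normHom p σ j δ ^ ((∑ i ∈ Finset.range p, i) * p ^ j)) :
    ∃ β : Kˣ, β ^ p = normHom p σ (j + 1) α ∧
      umap σ β = β * (normHom p σ j δ * normHom p σ (j + 1) η) := by
  set τ := σ ^ p ^ j with hτ
  set c := normHom p σ j δ with hc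
  set ν := normHom p σ j η with hν
  have hcσ : umap σ c = c := umap_normHom_of_mem hδ
  have hcτ : umap τ c = c := umap_pow_eq_self hcσ _
  have hατ : umap τ α = α * c * ν ^ p := by
    have h1 := umap_normHom_mul p σ j α
    rw [← normHom_umap, hα, map_mul, map_mul, map_pow, mul_assoc, mul_assoc] at h1
    have h2 := mul_left_cancel h1
    rw [← h2]
    simp only [hc, hν, mul_assoc, mul_comm, mul_left_comm]
  set Q := ∏ i ∈ Finset.range p, partialNorm τ i ν with hQ
  have hη : normHom p σ (j + 1) η = partialNorm τ p ν := by
    rw [normHom_succ, normHom_eq_partialNorm, partialNorm_comm, ← normHom_eq_partialNorm]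
  refine ⟨normHom p σ j (α * Q) * e, ?_, ?_⟩
  · rw [normHom_succ, partialNorm_of_umap_eq hcτ hατ p, mul_pow, hep, ← map_pow, mul_pow]
    simp only [map_mul]
    rw [normHom_eq_partialNorm p σ j (c ^ _), partialNorm_of_fixed (by rw [map_pow, hcσ]),
      ← pow_mul]
    ac_rfl
  · have h1 := umap_normHom_mul p σ j (α * Q)
    have h2 : umap τ (α * Q) = α * Q * (c * partialNorm τ p ν) := by
      apply mul_right_cancel (b := ν ^ p)
      rw [map_mul, mul_assoc, umap_prod_partialNorm, hατ]
      ac_rfl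
    rw [← hτ, h2] at h1
    have h3 : umap σ (normHom p σ j (α * Q)) =
        normHom p σ j (α * Q) * (c * partialNorm τ p ν) := by
      apply mul_right_cancel (b := α * Q)
      rw [h1]
      ac_rfl
    rw [map_mul, h3, he, hη]
    ac_rfl

end Helpers

end MSS

/-- **Proposition.**  Let `α ∈ K^×` be a `1`-exceptional element.  Then
`N_{K/F}(α)` is a `p`-th power in `K^×`, every `β` with `β^p = N_{K/F}(α)`
satisfies `(σ-1)β = ξ_p`, and `α ∉ K_{n-1}^×`. -/
theorem statement_9 {F : Type u} {K : Type v} [Field F] [Field K] [Algebra F K]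
    [IsGalois F K] [FiniteDimensional F K]
    (p n : ℕ) (hp : p.Prime) (hn : 0 < n)
    (σ : K ≃ₐ[F] K) (horder : orderOf σ = p ^ n)
    (hgen : ∀ τ : K ≃ₐ[F] K, τ ∈ Subgroup.zpowers σ)
    (ξ : Kˣ) (hξ : IsPrimitiveRoot (ξ : K) p)
    (hξF : (ξ : K) ∈ Set.range (algebraMap F K))
    (hspecial : p = 2 → n = 1 → ∃ γ : Kˣ, MSS.normHom p σ n γ = -1)
    (α : Kˣ) (hexc : MSS.IsExceptional p n σ ξ 1 α) :
    (∃ β : Kˣ, β ^ p = MSS.normHom p σ n α) ∧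
    (∀ β : Kˣ, β ^ p = MSS.normHom p σ n α → MSS.umap σ β * β⁻¹ = ξ) ∧
    α ∉ MSS.KiU p σ (n - 1) := by
  obtain ⟨j, rfl⟩ : ∃ j, n = j + 1 := ⟨n - 1, by omega⟩
  rw [Nat.add_sub_cancel]
  obtain ⟨a, d, δ, hmin, hlev, hσα, hnorm⟩ := hexc
  obtain ⟨e, he⟩ := hmin.1.2.2.1
  have hδ0 : δ 0 ∈ MSS.KiU p σ j := by
    have h0 := hlev 0
    have hlt := hmin.1.2.1 Nat.one_pos
    change a 0 < _ at hlt
    rcases ha : a 0 with _ | i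
    · rw [ha] at h0
      have h1 : δ 0 = 1 := h0
      rw [h1]; exact one_mem _
    · rw [ha] at h0 hlt
      have h1 : δ 0 ∈ MSS.KiU p σ i := h0
      have h2 : i < j + 1 := WithBot.coe_lt_coe.1 hlt
      exact MSS.KiU_mono (by omega) h1
  have hp0 : (p : ℤ) ≠ 0 := by exact_mod_cast hp.ne_zero
  have hα' : MSS.umap σ α = α * δ 0 * (α ^ e * δ 1) ^ p := by
    have hd : d = 1 + e * p := by linarith
    rw [hσα, hd, zpow_add, zpow_one, zpow_mul, zpow_natCast]
    simp only [Finset.prod_range_succ, Finset.prod_range_zero, pow_zero, pow_one, one_mul, mul_pow]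
    simp only [mul_assoc, mul_left_comm]
  have hξ' : MSS.normHom p σ j (δ 0) * MSS.normHom p σ (j + 1) (α ^ e * δ 1) = ξ := by
    rw [hnorm, he, Int.mul_ediv_cancel_left _ hp0]
    simp only [Nat.add_sub_cancel, Finset.Icc_self, Finset.prod_singleton, Nat.sub_self, pow_zero,
      pow_one, map_mul, map_zpow]
    ac_rfl
  have hcσ := MSS.umap_normHom_of_mem hδ0
  obtain ⟨c, hc, hcp⟩ : ∃ c : Kˣ, MSS.umap σ c = c ∧
      c ^ p = MSS.normHom p σ j (δ 0) ^ ((∑ i ∈ Finset.range p, i) * p ^ j) := by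
    by_cases hdvd : p ∣ (∑ i ∈ Finset.range p, i) * p ^ j
    · obtain ⟨k, hk⟩ := hdvd
      exact ⟨MSS.normHom p σ j (δ 0) ^ k, by rw [map_pow, hcσ],
        by rw [hk, ← pow_mul, mul_comm]⟩
    · have hj : j = 0 := by
        by_contra hj
        exact hdvd (Dvd.dvd.mul_left (dvd_pow_self p hj) _)
      have hp2 : p = 2 := by
        by_contra hp2
        have hodd := hp.odd_of_ne_two hp2
        obtain ⟨k, hk⟩ := hodd
        refine hdvd (Dvd.dvd.mul_right ⟨k, ?_⟩ _)
        have := Finset.sum_range_id_mul_two p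
        have h1 : p - 1 = k * 2 := by omega
        rw [h1, ← mul_assoc] at this
        exact Nat.eq_of_mul_eq_mul_right two_pos this
      subst hj hp2
      have hξ1 : ξ = -1 := Units.ext (by simpa using hξ.eq_neg_one_of_two_right)
      subst hξ1
      obtain ⟨γ, hγ⟩ := hspecial rfl rfl
      have hσ2 : σ ^ 2 = 1 := by simpa [horder] using pow_orderOf_eq_one σ
      have hσ1 : σ ≠ 1 := by rintro rfl; simp at horder
      have ha := MSS.eq_bot_of_isMinimalNormPair hσ2 hσ1 hγ hmin
      have h0 := hlev 0
      rw [ha] at h0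
      have h1 : δ 0 = 1 := h0
      exact ⟨1, map_one _, by simp [h1]⟩
  obtain ⟨β, hβ, hσβ⟩ := MSS.exists_pow_eq_normHom hδ0 hα' hc hcp
  rw [hξ'] at hσβ
  have hξfix : MSS.umap σ ξ = ξ := by
    obtain ⟨x, hx⟩ := hξF
    apply Units.ext
    rw [MSS.coe_umap, ← hx, AlgEquiv.commutes]
  have hall : ∀ β' : Kˣ, β' ^ p = MSS.normHom p σ (j + 1) α → MSS.umap σ β' * β'⁻¹ = ξ := by
    intro β' hβ'
    have hroot : ((β' / β : Kˣ) : K) ^ p = 1 := by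
      rw [← Units.val_pow_eq_pow_val, div_pow, hβ', hβ, div_self', Units.val_one]
    have : NeZero p := ⟨hp.ne_zero⟩
    obtain ⟨i, -, hi⟩ := hξ.eq_pow_of_pow_eq_one hroot
    have hi' : β' = ξ ^ i * β := by
      rw [← div_eq_iff_eq_mul]
      exact Units.ext (by rw [← hi, Units.val_pow_eq_pow_val])
    rw [hi', map_mul, map_pow, hξfix, hσβ, mul_inv_eq_iff_eq_mul]
    ac_rfl
  refine ⟨⟨β, hβ⟩, hall, fun hαj => ?_⟩
  have hfix := MSS.umap_normHom_of_mem hαj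
  have h1 := hall (MSS.normHom p σ j α) (by
    rw [MSS.normHom_succ, MSS.partialNorm_of_fixed (MSS.mem_KiU.1 hαj), map_pow])
  rw [hfix, mul_inv_cancel] at h1
  exact hξ.ne_one hp.one_lt (by rw [← h1, Units.val_one])
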